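/- The quotient of closed interface terms by provable equality in IFGcc is isomorphic as an abelian group to the free abelian group on active interface elements; equivalently, two closed interface terms are provably equal from axioms IFG1–IFG5 if and only if they have the same multiplicity at every active interface element. -/

import Mathlib

/-- Closed interface terms: built from `0`, active element constants `f.m@g`,
passive element constants `f̄.m@g`, `+`, and `−`. -/
inductive IFTerm (L M : Type) : Type
  | zero
  | act (f : L) (m : M) (g : L)   -- the active element constant `f.m@g`
  | pas (f : L) (m : M) (g : L)   -- the passive element constant `f̄.m@g`
  | add (i j : IFTerm L M)
  | neg (i : IFTerm L M)

/-- Provable equality in IFGcc: the congruence generated by axioms IFG1–IFG5. -/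
inductive Eqv {L M : Type} : IFTerm L M → IFTerm L M → Prop
  | refl (i : IFTerm L M) : Eqv i i
  | symm {i j} : Eqv i j → Eqv j i
  | trans {i j k} : Eqv i j → Eqv j k → Eqv i k
  | addCongr {i i' j j'} : Eqv i i' → Eqv j j' → Eqv (.add i j) (.add i' j')
  | negCongr {i i'} : Eqv i i' → Eqv (.neg i) (.neg i')
  | ifg1 (i : IFTerm L M) : Eqv (.add .zero i) i
  | ifg2 (i : IFTerm L M) : Eqv (.add (.neg i) i) .zero
  | ifg3 (i j h : IFTerm L M) : Eqv (.add (.add i j) h) (.add i (.add j h))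
  | ifg4 (i j : IFTerm L M) : Eqv (.add i j) (.add j i)
  | ifg5 (f g : L) (m : M) : Eqv (.add (.act f m g) (.pas g m f)) .zero

/-- The multiplicity of the active interface element `e` in a closed interface
term: `e` contributes `+1` to itself, the passive constant `x̄.m@y` contributes
`−1` to the active element `y.m@x`, `+` adds, `−` negates. -/
def multT {L M : Type} [DecidableEq L] [DecidableEq M]
    (e : L × M × L) : IFTerm L M → ℤ
  | .zero => 0
  | .act f m g => if e = (f, m, g) then 1 else 0
  | .pas f m g => if e = (g, m, f) then -1 else 0
  | .add i j => multT e i + multT e j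
  | .neg i => - multT e i

namespace IFTerm

/-- Provable equality as a setoid on closed interface terms. -/
def eqvSetoid (L M : Type) : Setoid (IFTerm L M) where
  r := Eqv
  iseqv := ⟨Eqv.refl, Eqv.symm, Eqv.trans⟩

/-- Closed interface terms modulo provable equality. -/
abbrev EqvQuotient (L M : Type) : Type := Quotient (eqvSetoid L M)

instance (L M : Type) : Zero (EqvQuotient L M) := ⟨Quotient.mk _ zero⟩

instance (L M : Type) : Add (EqvQuotient L M) :=
  ⟨Quotient.map₂ add fun _ _ h _ _ h' => Eqv.addCongr h h'⟩

instance (L M : Type) : Neg (EqvQuotient L M) :=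
  ⟨Quotient.map neg fun _ _ h => Eqv.negCongr h⟩

instance (L M : Type) : AddCommGroup (EqvQuotient L M) where
  add_assoc := by
    rintro ⟨a⟩ ⟨b⟩ ⟨c⟩
    exact Quotient.sound (Eqv.ifg3 a b c)
  zero_add := by
    rintro ⟨a⟩
    exact Quotient.sound (Eqv.ifg1 a)
  add_zero := by
    rintro ⟨a⟩
    exact Quotient.sound ((Eqv.ifg4 a zero).trans (Eqv.ifg1 a))
  neg_add_cancel := by
    rintro ⟨a⟩
    exact Quotient.sound (Eqv.ifg2 a)
  add_comm := by
    rintro ⟨a⟩ ⟨b⟩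
    exact Quotient.sound (Eqv.ifg4 a b)
  nsmul := nsmulRec
  zsmul := zsmulRec

/-- The class of a term modulo provable equality. -/
def toQuotient {L M : Type} (i : IFTerm L M) : EqvQuotient L M := Quotient.mk _ i

variable {L M : Type}

theorem toQuotient_add (i j : IFTerm L M) :
    toQuotient (add i j) = toQuotient i + toQuotient j := rfl

theorem toQuotient_neg (i : IFTerm L M) : toQuotient (neg i) = -toQuotient i := rfl

theorem toQuotient_pas (f : L) (m : M) (g : L) :
    toQuotient (pas f m g) = -toQuotient (act g m f) :=
  eq_neg_of_add_eq_zero_right (Quotient.sound (Eqv.ifg5 g f m))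

/-- All multiplicities of a term, collected in the free abelian group on active elements. -/
noncomputable def multFinsupp : IFTerm L M → (L × M × L →₀ ℤ)
  | zero => 0
  | act f m g => Finsupp.single (f, m, g) 1
  | pas f m g => -Finsupp.single (g, m, f) 1
  | add i j => multFinsupp i + multFinsupp j
  | neg i => -multFinsupp i

theorem multFinsupp_apply [DecidableEq L] [DecidableEq M] (e : L × M × L) (i : IFTerm L M) :
    multFinsupp i e = multT e i := by
  induction i with
  | zero => rfl
  | act f m g => simp [multFinsupp, multT, Finsupp.single_apply, eq_comm]
  | pas f m g =>
    simp only [multFinsupp, multT, Finsupp.neg_apply, Finsupp.single_apply, eq_comm (a := e)]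
    split_ifs <;> rfl
  | add i j hi hj => simp [multFinsupp, multT, hi, hj]
  | neg i hi => simp [multFinsupp, multT, hi]

/-- The homomorphism from the free abelian group on active elements to terms modulo provable
equality that extends the inclusion of active elements. -/
noncomputable def ofFinsupp : (L × M × L →₀ ℤ) →+ EqvQuotient L M :=
  Finsupp.liftAddHom fun e => zmultiplesHom _ (toQuotient (act e.1 e.2.1 e.2.2))

theorem ofFinsupp_multFinsupp (i : IFTerm L M) : ofFinsupp (multFinsupp i) = toQuotient i := by
  induction i with
  | zero => exact map_zero _
  | act f m g => simp [multFinsupp, ofFinsupp]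
  | pas f m g =>
    rw [multFinsupp, map_neg, toQuotient_pas]
    simp [ofFinsupp]
  | add i j hi hj => rw [multFinsupp, map_add, hi, hj, toQuotient_add]
  | neg i hi => rw [multFinsupp, map_neg, hi, toQuotient_neg]

end IFTerm

theorem Eqv.multT_eq {L M : Type} [DecidableEq L] [DecidableEq M] {i j : IFTerm L M}
    (h : Eqv i j) (e : L × M × L) : multT e i = multT e j := by
  induction h with
  | refl => rfl
  | symm _ ih => exact ih.symm
  | trans _ _ ih ih' => exact ih.trans ih'
  | addCongr _ _ ih ih' => simp only [multT, ih, ih']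
  | negCongr _ ih => simp only [multT, ih]
  | ifg1 => simp [multT]
  | ifg2 => simp [multT]
  | ifg3 => simp [multT, add_assoc]
  | ifg4 => simp [multT, add_comm]
  | ifg5 => simp only [multT]; split_ifs <;> rfl

/-- The quotient of closed interface terms by provable equality in IFGcc is
the free abelian group on active interface elements: two closed interface
terms are provably equal from IFG1–IFG5 iff they have the same multiplicity at
every active interface element. -/
theorem eqv_iff_mult (L M : Type) [DecidableEq L] [DecidableEq M]
    (i j : IFTerm L M) :
    Eqv i j ↔ ∀ e : L × M × L, multT e i = multT e j := by
  refine ⟨Eqv.multT_eq, fun h => ?_⟩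
  have hij : i.multFinsupp = j.multFinsupp := by
    ext e
    rw [IFTerm.multFinsupp_apply, IFTerm.multFinsupp_apply, h]
  have hq : i.toQuotient = j.toQuotient := by
    rw [← IFTerm.ofFinsupp_multFinsupp, hij, IFTerm.ofFinsupp_multFinsupp]
  exact Quotient.exact hq
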